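/- In addition assume there exist a nonempty closed set Γ ⊆ ℝⁿ and h₀ ∈ ℝ such that H(p,y) = h₀ for every p ∈ Γ and y ∈ ℝⁿ, while h₀ < inf_{y∈ℝⁿ} H(p,y) for every p ∈ ℝⁿ∖Γ. Then min_{ℝⁿ} \overline{H} = h₀ and {p ∈ ℝⁿ : \overline{H}(p) = min \overline{H}} = Γ. In particular, if Γ has empty interior then argmin \overline{H} has empty interior. -/

import Mathlib

open MeasureTheory Filter Metric Set
open scoped NNReal

noncomputable section

/-- ℝⁿ as a Euclidean space. -/
abbrev Ed (n : ℕ) := EuclideanSpace ℝ (Fin n)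

/-- The admissible set of levels `μ` in the definition of the effective Hamiltonian. -/
def effSet {n : ℕ} (H : Ed n → Ed n → ℝ) (p : Ed n) : Set ℝ :=
  {μ : ℝ | ∃ w : Ed n → ℝ,
    (∃ K : ℝ≥0, LipschitzWith K w) ∧
    Tendsto (fun y : Ed n => w y / ‖y‖) (cocompact (Ed n)) (nhds 0) ∧
    ∀ᵐ y ∂(volume : Measure (Ed n)), H (p + gradient w y) y ≤ μ}

/-- The effective Hamiltonian `H̄(p)`. -/
def effH {n : ℕ} (H : Ed n → Ed n → ℝ) (p : Ed n) : ℝ :=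
  sInf (effSet H p)

/-- If the derivative of a real Lipschitz function is at most `-c` almost everywhere, then the
function decreases at rate at least `c`. -/
lemma LipschitzWith.le_sub_mul_of_ae_deriv_le {f : ℝ → ℝ} {K : ℝ≥0} (hf : LipschitzWith K f)
    {c : ℝ} (hc : ∀ᵐ t, deriv f t ≤ -c) {t : ℝ} (ht : 0 ≤ t) : f t ≤ f 0 - c * t := by
  have hac : AbsolutelyContinuousOnInterval f 0 t :=
    hf.lipschitzOnWith.absolutelyContinuousOnInterval
  have hle : ∫ x in (0 : ℝ)..t, deriv f x ≤ ∫ _ in (0 : ℝ)..t, -c :=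
    intervalIntegral.integral_mono_ae ht hac.intervalIntegrable_deriv
      intervalIntegrable_const hc
  rw [hac.integral_deriv_eq_sub, intervalIntegral.integral_const, smul_eq_mul] at hle
  linarith

section Slope

variable {E : Type*} [NormedAddCommGroup E] [NormedSpace ℝ E]

/-- If the directional derivative in direction `v` of a Lipschitz function is a.e. at most `-c`,
then the function decreases at rate at least `c` along almost every line of direction `v`. -/
lemma LipschitzWith.ae_le_sub_mul_of_ae_fderiv_le [FiniteDimensional ℝ E] [MeasurableSpace E]
    [BorelSpace E] {μ : Measure E} [μ.IsAddHaarMeasure] {w : E → ℝ} {K : ℝ≥0}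
    (hw : LipschitzWith K w) {v : E} {c : ℝ} (hc : ∀ᵐ y ∂μ, fderiv ℝ w y v ≤ -c) :
    ∀ᵐ y ∂μ, ∀ t : ℝ, 0 ≤ t → w (y + t • v) ≤ w y - c * t := by
  obtain ⟨s, hsub, hsm, hs⟩ : ∃ s ⊆ {y | DifferentiableAt ℝ w y ∧ fderiv ℝ w y v ≤ -c},
      MeasurableSet s ∧ ∀ᵐ y ∂μ, y ∈ s := by
    obtain ⟨s, hs, hsm, hsub⟩ := (hw.ae_differentiableAt.and hc).exists_measurable_mem
    exact ⟨s, hsub, hsm, hs⟩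
  let L : ℝ →ₗ[ℝ] E := LinearMap.toSpanSingleton ℝ E v
  filter_upwards [(ae_ae_add_linearMap_mem_iff L volume μ hsm).2 hs] with y hy t ht
  have hline : LipschitzWith (K * ‖v‖₊) fun t : ℝ => w (y + t • v) := by
    refine hw.comp (LipschitzWith.of_dist_le_mul fun a b => ?_)
    rw [dist_add_left, dist_eq_norm, ← sub_smul, norm_smul, Real.dist_eq, mul_comm,
      Real.norm_eq_abs, coe_nnnorm]
  have hderiv : ∀ᵐ t : ℝ, deriv (fun t : ℝ => w (y + t • v)) t ≤ -c := by
    filter_upwards [hy] with t ht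
    obtain ⟨hd, hle⟩ := hsub ht
    have hpath : HasDerivAt (fun t : ℝ => y + t • v) v t := by
      simpa using ((hasDerivAt_id t).smul_const v).const_add y
    have hcomp : HasDerivAt (fun t : ℝ => w (y + t • v)) (fderiv ℝ w (y + t • v) v) t :=
      HasFDerivAt.comp_hasDerivAt t hd.hasFDerivAt hpath
    rw [hcomp.deriv]
    exact hle
  simpa using hline.le_sub_mul_of_ae_deriv_le hderiv ht

/-- A function that is strictly sublinear at infinity cannot decrease at a positive rate along a
half-line. -/
lemma not_forall_le_sub_mul_of_sublinear [ProperSpace E] {w : E → ℝ}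
    (hw : Tendsto (fun y => w y / ‖y‖) (cocompact E) (nhds 0)) {c : ℝ} (hc : 0 < c) (y v : E) :
    ¬ ∀ t : ℝ, 0 ≤ t → w (y + t • v) ≤ w y - c * t := by
  intro h
  have hv : 0 < ‖v‖ := by
    rw [norm_pos_iff]
    rintro rfl
    have := h 1 zero_le_one
    simp only [smul_zero, add_zero] at this
    linarith
  have hnorm : Tendsto (fun t : ℝ => ‖y + t • v‖) atTop atTop := by
    refine tendsto_atTop_mono' atTop ?_ (tendsto_atTop_add_const_right atTop (-‖y‖)
      (tendsto_id.atTop_mul_const hv))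
    filter_upwards [eventually_ge_atTop 0] with t ht
    have := norm_sub_le (y + t • v) y
    rw [add_sub_cancel_left, norm_smul, Real.norm_of_nonneg ht] at this
    simp only [id]
    linarith
  have hcoc : Tendsto (fun t : ℝ => y + t • v) atTop (cocompact E) :=
    (tendsto_norm_atTop_iff_cobounded.1 hnorm).mono_right Metric.cobounded_eq_cocompact.le
  set ε := c / (2 * ‖v‖) with hε
  have hεpos : 0 < ε := by positivity
  have hsmall : ∀ᶠ t : ℝ in atTop, -ε < w (y + t • v) / ‖y + t • v‖ :=
    (hw.comp hcoc).eventually (lt_mem_nhds (neg_lt_zero.2 hεpos))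
  obtain ⟨t, hlow, hpos, ht, hlarge⟩ := (hsmall.and ((hnorm.eventually_gt_atTop 0).and
    ((eventually_ge_atTop 0).and (eventually_gt_atTop ((w y + ε * ‖y‖) / (c / 2)))))).exists
  rw [lt_div_iff₀ hpos] at hlow
  rw [div_lt_iff₀ (by positivity)] at hlarge
  have htri : ‖y + t • v‖ ≤ ‖y‖ + t * ‖v‖ := by
    simpa [norm_smul, abs_of_nonneg ht] using norm_add_le y (t • v)
  have hεv : ε * ‖v‖ = c / 2 := by rw [hε]; field_simp
  have hbound : ε * ‖y + t • v‖ ≤ ε * ‖y‖ + t * (c / 2) := by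
    calc ε * ‖y + t • v‖ ≤ ε * (‖y‖ + t * ‖v‖) := by gcongr
      _ = ε * ‖y‖ + t * (ε * ‖v‖) := by ring
      _ = _ := by rw [hεv]
  linarith [h t ht]

end Slope

/-- A coercive Hamiltonian lying above `h₀`, uniformly in `y`, at each point of a closed set `F` of
momenta is uniformly above `h₀` on `F`. -/
lemma exists_forall_add_le_of_isClosed {n : ℕ} {H : Ed n → Ed n → ℝ}
    (hcoer : ∀ C : ℝ, ∃ R : ℝ, ∀ p y, R ≤ ‖p‖ → C ≤ H p y)
    (huc : ∀ R > (0 : ℝ),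
      UniformContinuousOn (fun q : Ed n × Ed n => H q.1 q.2) (Metric.ball 0 R ×ˢ Set.univ))
    {h₀ : ℝ} {F : Set (Ed n)} (hF : IsClosed F)
    (habove : ∀ p ∈ F, ∃ ε > 0, ∀ y, h₀ + ε ≤ H p y) :
    ∃ ε > 0, ∀ p ∈ F, ∀ y, h₀ + ε ≤ H p y := by
  obtain ⟨R, hR⟩ := hcoer (h₀ + 1)
  have hcompact : ∃ ε > 0, ∀ p ∈ F ∩ closedBall 0 R, ∀ y, h₀ + ε ≤ H p y := by
    refine ((isCompact_closedBall (0 : Ed n) R).inter_left hF).induction_on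
      (p := fun s => ∃ ε > 0, ∀ p ∈ s, ∀ y, h₀ + ε ≤ H p y) ⟨1, one_pos, by simp⟩ ?_ ?_ ?_
    · rintro s t hst ⟨ε, hε, h⟩
      exact ⟨ε, hε, fun p hp => h p (hst hp)⟩
    · rintro s t ⟨ε, hε, hs⟩ ⟨δ, hδ, ht⟩
      refine ⟨min ε δ, lt_min hε hδ, ?_⟩
      rintro p (hp | hp) y
      · linarith [hs p hp y, min_le_left ε δ]
      · linarith [ht p hp y, min_le_right ε δ]
    · rintro p ⟨hpF, -⟩
      obtain ⟨ε, hε, hp⟩ := habove p hpF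
      obtain ⟨δ, hδ, hclose⟩ := Metric.uniformContinuousOn_iff.1
        (huc (‖p‖ + 1) (by positivity)) (ε / 2) (by positivity)
      refine ⟨ball p (min δ 1), mem_nhdsWithin_of_mem_nhds
        (ball_mem_nhds p (lt_min hδ one_pos)), ε / 2, by positivity, fun q hq y => ?_⟩
      rw [mem_ball, lt_min_iff] at hq
      have hqball : ‖q‖ < ‖p‖ + 1 := by
        have := norm_sub_norm_le q p
        rw [dist_eq_norm] at hq
        linarith [hq.2]
      have hdist := hclose (q, y) ⟨by simpa using hqball, mem_univ _⟩ (p, y)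
        ⟨by simp, mem_univ _⟩ (by simpa [Prod.dist_eq, hδ] using hq.1)
      rw [Real.dist_eq, abs_lt] at hdist
      linarith [hp y, hdist.1]
  obtain ⟨ε, hε, hball⟩ := hcompact
  refine ⟨min ε 1, lt_min hε one_pos, fun p hp y => ?_⟩
  rcases le_total R ‖p‖ with h | h
  · linarith [hR p y h, min_le_right ε 1]
  · linarith [hball p ⟨hp, by simpa using h⟩ y, min_le_left ε 1]

/-- The zero function is an admissible corrector for any upper bound of `H p`. -/
lemma mem_effSet_of_forall_le {n : ℕ} {H : Ed n → Ed n → ℝ} {p : Ed n} {C : ℝ}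
    (h : ∀ y, H p y ≤ C) : C ∈ effSet H p := by
  refine ⟨fun _ => 0, ⟨0, LipschitzWith.const 0⟩,
    by simpa using tendsto_const_nhds, ae_of_all _ fun y => ?_⟩
  rw [gradient_fun_const, add_zero]
  exact h y

/-- A lower bound of `H` is a lower bound of all admissible levels. -/
lemma le_of_mem_effSet {n : ℕ} {H : Ed n → Ed n → ℝ} {p : Ed n} {h₀ μ : ℝ}
    (h : ∀ p y, h₀ ≤ H p y) (hμ : μ ∈ effSet H p) : h₀ ≤ μ := by
  obtain ⟨w, -, -, hw⟩ := hμ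
  obtain ⟨y, hy⟩ := hw.exists
  exact (h _ y).trans hy

/-- A lower bound of `H` on a half-space of momenta `{q | u ≤ f q}` containing `p` in its interior
is a lower bound of all admissible levels at `p`. -/
lemma le_of_mem_effSet_of_halfSpace {n : ℕ} {H : Ed n → Ed n → ℝ} {p : Ed n} {m μ u : ℝ}
    (f : StrongDual ℝ (Ed n)) (hp : u < f p) (h : ∀ q, u ≤ f q → ∀ y, m ≤ H q y)
    (hμ : μ ∈ effSet H p) : m ≤ μ := by
  by_contra! hlt
  obtain ⟨w, ⟨K, hK⟩, hsub, hw⟩ := hμ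
  let v : Ed n := (InnerProductSpace.toDual ℝ (Ed n)).symm f
  have hslope : ∀ᵐ y ∂(volume : Measure (Ed n)), fderiv ℝ w y v ≤ -(f p - u) := by
    filter_upwards [hw] with y hy
    have hfu : f (p + gradient w y) < u := by
      by_contra! hge
      exact (hlt.trans_le (h _ hge y)).not_ge hy
    have hdual : fderiv ℝ w y v = f (gradient w y) := by
      rw [← toDual_gradient, InnerProductSpace.toDual_apply_apply, real_inner_comm,
        InnerProductSpace.toDual_symm_apply]
    rw [map_add] at hfu
    linarith
  obtain ⟨y, hy⟩ := (hK.ae_le_sub_mul_of_ae_fderiv_le hslope).exists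
  exact not_forall_le_sub_mul_of_sublinear hsub (sub_pos.2 hp) y v hy

/-- If `H ≡ h₀` on `Γ × ℝⁿ` and `h₀ < inf_y H(p,y)` for `p ∉ Γ`, then `min H̄ = h₀` and
`argmin H̄ = Γ`; in particular if `Γ` has empty interior then so does `argmin H̄`. -/
theorem stmt_13
    (n : ℕ) (hn : 1 ≤ n)
    (H : Ed n → Ed n → ℝ)
    (hconv : ∀ y, ConvexOn ℝ Set.univ (fun p => H p y))
    (hcoer : ∀ C : ℝ, ∃ R : ℝ, ∀ p y, R ≤ ‖p‖ → C ≤ H p y)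
    (hreg : ∀ R > (0 : ℝ),
      UniformContinuousOn (fun q : Ed n × Ed n => H q.1 q.2) (Metric.ball 0 R ×ˢ Set.univ) ∧
      ∃ C : ℝ, ∀ p y, ‖p‖ < R → |H p y| ≤ C)
    (Γ : Set (Ed n)) (hΓne : Γ.Nonempty) (hΓcl : IsClosed Γ)
    (h₀ : ℝ)
    (hflat : ∀ p ∈ Γ, ∀ y : Ed n, H p y = h₀)
    (habove : ∀ p ∉ Γ, h₀ < ⨅ y, H p y) :
    (∀ p : Ed n, h₀ ≤ effH H p) ∧
    {p : Ed n | effH H p = h₀} = Γ ∧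
    {p : Ed n | ∀ q, effH H p ≤ effH H q} = Γ ∧
    (interior Γ = ∅ → interior {p : Ed n | ∀ q, effH H p ≤ effH H q} = ∅) := by
  have hbdd : ∀ p, BddBelow (range (H p)) := fun p => by
    obtain ⟨-, C, hC⟩ := hreg (‖p‖ + 1) (by positivity)
    exact ⟨-C, forall_mem_range.2 fun y => (abs_le.1 (hC p y (lt_add_one _))).1⟩
  have hgap : ∀ p ∉ Γ, ∃ ε > 0, ∀ y, h₀ + ε ≤ H p y := fun p hp =>
    ⟨(⨅ y, H p y) - h₀, sub_pos.2 (habove p hp), fun y => by linarith [ciInf_le (hbdd p) y]⟩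
  have hmin : ∀ p y, h₀ ≤ H p y := fun p y => by
    by_cases hp : p ∈ Γ
    · exact (hflat p hp y).ge
    · exact (habove p hp).le.trans (ciInf_le (hbdd p) y)
  have hne : ∀ p, (effSet H p).Nonempty := fun p => by
    obtain ⟨-, C, hC⟩ := hreg (‖p‖ + 1) (by positivity)
    exact ⟨C, mem_effSet_of_forall_le fun y => (abs_le.1 (hC p y (lt_add_one _))).2⟩
  have hlow : ∀ p, h₀ ≤ effH H p := fun p =>
    le_csInf (hne p) fun μ hμ => le_of_mem_effSet hmin hμ
  have hΓ : ∀ p ∈ Γ, effH H p = h₀ := fun p hp =>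
    (csInf_le ⟨h₀, fun μ hμ => le_of_mem_effSet hmin hμ⟩
      (mem_effSet_of_forall_le fun y => (hflat p hp y).le)).antisymm (hlow p)
  have hΓconv : Convex ℝ Γ := by
    have hset : Γ = {p ∈ Set.univ | H p 0 ≤ h₀} := by
      ext p
      refine ⟨fun hp => ⟨mem_univ p, (hflat p hp 0).le⟩, fun hp => ?_⟩
      by_contra hpΓ
      obtain ⟨ε, hε, h⟩ := hgap p hpΓ
      linarith [h 0, hp.2]
    rw [hset]
    exact (hconv 0).convex_le h₀
  have hstrict : ∀ p ∉ Γ, h₀ < effH H p := fun p hp => by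
    obtain ⟨f, u, hfΓ, hfp⟩ := geometric_hahn_banach_closed_point hΓconv hΓcl hp
    obtain ⟨ε, hε, h⟩ := exists_forall_add_le_of_isClosed hcoer (fun R hR => (hreg R hR).1)
      (F := {q | u ≤ f q}) (isClosed_le continuous_const f.continuous)
      (fun q hq => hgap q fun hqΓ => (hfΓ q hqΓ).not_ge hq)
    calc h₀ < h₀ + ε := lt_add_of_pos_right _ hε
      _ ≤ effH H p := le_csInf (hne p) fun μ hμ => le_of_mem_effSet_of_halfSpace f hfp h hμ
  have hlevel : {p : Ed n | effH H p = h₀} = Γ := by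
    ext p
    exact ⟨fun hp => by_contra fun hpΓ => (hstrict p hpΓ).ne' hp, hΓ p⟩
  have hargmin : {p : Ed n | ∀ q, effH H p ≤ effH H q} = Γ := by
    ext p
    refine ⟨fun hp => ?_, fun hp q => (hΓ p hp).le.trans (hlow q)⟩
    obtain ⟨q, hq⟩ := hΓne
    by_contra hpΓ
    exact (hstrict p hpΓ).not_ge ((hp q).trans (hΓ q hq).le)
  exact ⟨hlow, hlevel, hargmin, fun h => by rw [hargmin, h]⟩

end
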